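/- Let T be the linear operator on the 28-dimensional real vector space of antisymmetric 8×8 real matrices defined by (T F)_{μν} = (1/2) Σ_{ρ,σ} Ω_{μνρσ} F_{ρσ}. Then the eigenspace of T with eigenvalue −1 has dimension 21, the eigenspace of T with eigenvalue 3 has dimension 7, and the space of antisymmetric 8×8 real matrices is the direct sum of these two eigenspaces. -/

import Mathlib

/-- The 14 basic (ascending) index quadruples of the Spin(7) four-form `Ω` on ℝ⁸,
together with their values. -/
def OmegaBase : List ((Fin 4 → Fin 8) × ℝ) :=
  [(![0,1,2,3], 1), (![0,1,4,5], 1), (![0,1,6,7], 1), (![0,2,4,6], 1),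
   (![0,2,5,7], -1), (![0,3,4,7], -1), (![0,3,5,6], -1),
   (![1,2,4,7], -1), (![1,2,5,6], -1), (![1,3,4,6], -1),
   (![1,3,5,7], 1), (![2,3,4,5], 1), (![2,3,6,7], 1), (![4,5,6,7], 1)]

/-- The totally antisymmetric array `Ω_{μνρσ}`. -/
noncomputable def Omega (μ ν ρ σ : Fin 8) : ℝ :=
  (OmegaBase.map fun p =>
    p.2 * Matrix.det (Matrix.of fun i j =>
      if p.1 i = ![μ, ν, ρ, σ] j then (1 : ℝ) else 0)).sum

/-- The linear operator `T`, `(T F)_{μν} = (1/2) Σ_{ρσ} Ω_{μνρσ} F_{ρσ}`, as a linear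
endomorphism of the space of `8 × 8` real matrices. -/
noncomputable def TOmega : Matrix (Fin 8) (Fin 8) ℝ →ₗ[ℝ] Matrix (Fin 8) (Fin 8) ℝ where
  toFun F := Matrix.of fun μ ν => (1 / 2) * ∑ ρ : Fin 8, ∑ σ : Fin 8, Omega μ ν ρ σ * F ρ σ
  map_add' F G := by
    ext μ ν
    simp [Matrix.add_apply, mul_add, Finset.sum_add_distrib, mul_comm]
  map_smul' c F := by
    ext μ ν
    simp [Matrix.smul_apply, Finset.mul_sum, smul_eq_mul]
    congr 1; funext ρ; congr 1; funext σ; ring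

/-- The submodule of antisymmetric `8 × 8` real matrices (a 28-dimensional space). -/
def SkewMat : Submodule ℝ (Matrix (Fin 8) (Fin 8) ℝ) where
  carrier := {F | ∀ μ ν, F μ ν = -F ν μ}
  add_mem' := by
    intro a b ha hb μ ν
    simp [Matrix.add_apply, ha μ ν, hb μ ν]; ring
  zero_mem' := by intro μ ν; simp
  smul_mem' := by
    intro c a ha μ ν
    simp [Matrix.smul_apply, ha μ ν]

noncomputable def mnr (a b μ ν : Fin 8) : ℝ :=
  (if a = μ then 1 else 0) * (if b = ν then 1 else 0) -
  (if b = μ then 1 else 0) * (if a = ν then 1 else 0)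

lemma det_key (p : Fin 4 → Fin 8) (F : Matrix (Fin 8) (Fin 8) ℝ) (hF : ∀ μ ν, F μ ν = -F ν μ)
    (μ ν : Fin 8) :
    ∑ ρ : Fin 8, ∑ σ : Fin 8, Matrix.det (Matrix.of fun i j =>
      if p i = ![μ, ν, ρ, σ] j then (1 : ℝ) else 0) * F ρ σ =
    2 * (mnr (p 0) (p 1) μ ν * F (p 2) (p 3) - mnr (p 0) (p 2) μ ν * F (p 1) (p 3)
      + mnr (p 0) (p 3) μ ν * F (p 1) (p 2) + mnr (p 1) (p 2) μ ν * F (p 0) (p 3)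
      - mnr (p 1) (p 3) μ ν * F (p 0) (p 2) + mnr (p 2) (p 3) μ ν * F (p 0) (p 1)) := by
  have hs : ∀ a b : Fin 8, ∑ ρ : Fin 8, ∑ σ : Fin 8, mnr a b ρ σ * F ρ σ = 2 * F a b := by
    intro a b
    simp only [mnr, sub_mul, Finset.sum_sub_distrib, ite_mul, one_mul, zero_mul, mul_ite, mul_one, mul_zero]
    simp
    rw [hF b a]; ring
  have hd : ∀ ρ σ : Fin 8, Matrix.det (Matrix.of fun i j =>
      if p i = ![μ, ν, ρ, σ] j then (1 : ℝ) else 0) * F ρ σ =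
      mnr (p 0) (p 1) μ ν * (mnr (p 2) (p 3) ρ σ * F ρ σ)
      - mnr (p 0) (p 2) μ ν * (mnr (p 1) (p 3) ρ σ * F ρ σ)
      + mnr (p 0) (p 3) μ ν * (mnr (p 1) (p 2) ρ σ * F ρ σ)
      + mnr (p 1) (p 2) μ ν * (mnr (p 0) (p 3) ρ σ * F ρ σ)
      - mnr (p 1) (p 3) μ ν * (mnr (p 0) (p 2) ρ σ * F ρ σ)
      + mnr (p 2) (p 3) μ ν * (mnr (p 0) (p 1) ρ σ * F ρ σ) := by
    intro ρ σ
    generalize hm : (Matrix.of fun i j =>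
      if p i = ![μ, ν, ρ, σ] j then (1 : ℝ) else 0) = m
    have h : ∀ i j k l : Fin 4, ∀ a b : Fin 8, ![μ, ν, ρ, σ] k = a → ![μ, ν, ρ, σ] l = b →
        mnr (p i) (p j) a b = m i k * m j l - m j k * m i l := by
      rintro i j k l a b rfl rfl
      simp [mnr, ← hm]
    simp only [h _ _ 0 1 μ ν rfl rfl, h _ _ 2 3 ρ σ rfl rfl]
    simp [Matrix.det_succ_row_zero, Fin.sum_univ_succ, Fin.succAbove]
    ring
  simp only [hd, Finset.sum_add_distrib, Finset.sum_sub_distrib, ← Finset.mul_sum, hs]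
  ring


lemma mnr_swap (a b μ ν : Fin 8) : mnr a b ν μ = - mnr a b μ ν := by
  simp only [mnr]; ring

lemma TOmega_gen (F : Matrix (Fin 8) (Fin 8) ℝ) (hF : ∀ μ ν, F μ ν = -F ν μ) (μ ν : Fin 8) :
    TOmega F μ ν = (OmegaBase.map fun p => p.2 *
    (mnr (p.1 0) (p.1 1) μ ν * F (p.1 2) (p.1 3) - mnr (p.1 0) (p.1 2) μ ν * F (p.1 1) (p.1 3)
      + mnr (p.1 0) (p.1 3) μ ν * F (p.1 1) (p.1 2) + mnr (p.1 1) (p.1 2) μ ν * F (p.1 0) (p.1 3)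
      - mnr (p.1 1) (p.1 3) μ ν * F (p.1 0) (p.1 2)
      + mnr (p.1 2) (p.1 3) μ ν * F (p.1 0) (p.1 1))).sum := by
  have h : TOmega F μ ν = (1 / 2) * (OmegaBase.map fun p => p.2 *
      ∑ ρ : Fin 8, ∑ σ : Fin 8, Matrix.det (Matrix.of fun i j =>
      if p.1 i = ![μ, ν, ρ, σ] j then (1 : ℝ) else 0) * F ρ σ).sum := by
    simp only [TOmega, Omega, OmegaBase, LinearMap.coe_mk, AddHom.coe_mk, Matrix.of_apply,
      List.map_cons, List.map_nil, List.sum_cons, List.sum_nil, add_zero, add_mul,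
      Finset.sum_add_distrib, mul_assoc, ← Finset.mul_sum]
  rw [h, ← List.sum_map_mul_left]
  simp only [det_key _ F hF]
  congr 2
  funext p
  ring

lemma TOmega_skew (F : Matrix (Fin 8) (Fin 8) ℝ) (hF : ∀ μ ν, F μ ν = -F ν μ) (μ ν : Fin 8) :
    TOmega F μ ν = - TOmega F ν μ := by
  rw [TOmega_gen F hF, TOmega_gen F hF, ← neg_one_mul, ← List.sum_map_mul_left]
  congr 2
  funext p
  simp only [mnr_swap _ _ μ ν]
  ring

set_option maxHeartbeats 4000000 in
lemma TOmega_eq (F : Matrix (Fin 8) (Fin 8) ℝ) (hF : ∀ μ ν, F μ ν = -F ν μ) :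
    TOmega F 0 1 = F 2 3 + F 4 5 + F 6 7 ∧
    TOmega F 0 2 = -F 1 3 + F 4 6 - F 5 7 ∧
    TOmega F 0 3 = F 1 2 - F 4 7 - F 5 6 ∧
    TOmega F 0 4 = -F 1 5 - F 2 6 + F 3 7 ∧
    TOmega F 0 5 = F 1 4 + F 2 7 + F 3 6 ∧
    TOmega F 0 6 = -F 1 7 + F 2 4 - F 3 5 ∧
    TOmega F 0 7 = F 1 6 - F 2 5 - F 3 4 ∧
    TOmega F 1 2 = F 0 3 - F 4 7 - F 5 6 ∧
    TOmega F 1 3 = -F 0 2 - F 4 6 + F 5 7 ∧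
    TOmega F 1 4 = F 0 5 + F 2 7 + F 3 6 ∧
    TOmega F 1 5 = -F 0 4 + F 2 6 - F 3 7 ∧
    TOmega F 1 6 = F 0 7 - F 2 5 - F 3 4 ∧
    TOmega F 1 7 = -F 0 6 - F 2 4 + F 3 5 ∧
    TOmega F 2 3 = F 0 1 + F 4 5 + F 6 7 ∧
    TOmega F 2 4 = F 0 6 - F 1 7 - F 3 5 ∧
    TOmega F 2 5 = -F 0 7 - F 1 6 + F 3 4 ∧
    TOmega F 2 6 = -F 0 4 + F 1 5 - F 3 7 ∧
    TOmega F 2 7 = F 0 5 + F 1 4 + F 3 6 ∧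
    TOmega F 3 4 = -F 0 7 - F 1 6 + F 2 5 ∧
    TOmega F 3 5 = -F 0 6 + F 1 7 - F 2 4 ∧
    TOmega F 3 6 = F 0 5 + F 1 4 + F 2 7 ∧
    TOmega F 3 7 = F 0 4 - F 1 5 - F 2 6 ∧
    TOmega F 4 5 = F 0 1 + F 2 3 + F 6 7 ∧
    TOmega F 4 6 = F 0 2 - F 1 3 - F 5 7 ∧
    TOmega F 4 7 = -F 0 3 - F 1 2 + F 5 6 ∧
    TOmega F 5 6 = -F 0 3 - F 1 2 + F 4 7 ∧
    TOmega F 5 7 = -F 0 2 + F 1 3 - F 4 6 ∧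
    TOmega F 6 7 = F 0 1 + F 2 3 + F 4 5 := by
  have h := TOmega_gen F hF
  simp only [OmegaBase, List.map_cons, List.map_nil, List.sum_cons, List.sum_nil,
    Matrix.cons_val, add_zero, one_mul, neg_one_mul, Fin.isValue] at h
  refine ⟨?_, ?_, ?_, ?_, ?_, ?_, ?_, ?_, ?_, ?_, ?_, ?_, ?_, ?_, ?_, ?_, ?_, ?_, ?_, ?_, ?_, ?_, ?_, ?_, ?_, ?_, ?_, ?_⟩
  all_goals
    rw [h]
    simp only [mnr, Fin.isValue, Fin.reduceEq, if_true, if_false, mul_zero, zero_mul, mul_one, one_mul,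
      sub_zero, zero_sub, add_zero, zero_add, neg_zero, neg_neg, neg_mul]
    try ring

lemma skew_ext (F G : Matrix (Fin 8) (Fin 8) ℝ) (hF : ∀ μ ν, F μ ν = -F ν μ)
    (hG : ∀ μ ν, G μ ν = -G ν μ) (h : F 0 1 = G 0 1 ∧ F 0 2 = G 0 2 ∧ F 0 3 = G 0 3 ∧ F 0 4 = G 0 4 ∧ F 0 5 = G 0 5 ∧ F 0 6 = G 0 6 ∧ F 0 7 = G 0 7 ∧ F 1 2 = G 1 2 ∧ F 1 3 = G 1 3 ∧ F 1 4 = G 1 4 ∧ F 1 5 = G 1 5 ∧ F 1 6 = G 1 6 ∧ F 1 7 = G 1 7 ∧ F 2 3 = G 2 3 ∧ F 2 4 = G 2 4 ∧ F 2 5 = G 2 5 ∧ F 2 6 = G 2 6 ∧ F 2 7 = G 2 7 ∧ F 3 4 = G 3 4 ∧ F 3 5 = G 3 5 ∧ F 3 6 = G 3 6 ∧ F 3 7 = G 3 7 ∧ F 4 5 = G 4 5 ∧ F 4 6 = G 4 6 ∧ F 4 7 = G 4 7 ∧ F 5 6 = G 5 6 ∧ F 5 7 = G 5 7 ∧ F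 6 7 = G 6 7) : F = G := by
  obtain ⟨h01, h02, h03, h04, h05, h06, h07, h12, h13, h14, h15, h16, h17, h23, h24, h25, h26, h27, h34, h35, h36, h37, h45, h46, h47, h56, h57, h67⟩ := h
  have key : ∀ μ ν, μ < ν → F μ ν = G μ ν := by
    intro μ ν hlt
    fin_cases μ <;> fin_cases ν <;> first | assumption | exact absurd hlt (by decide)
  ext μ ν
  rcases lt_trichotomy μ ν with h | rfl | h
  · exact key _ _ h
  · linarith [hF μ μ, hG μ μ]
  · rw [hF, hG, key _ _ h]


set_option maxHeartbeats 4000000 in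
lemma mem3 (F : Matrix (Fin 8) (Fin 8) ℝ) :
    F ∈ SkewMat ⊓ Module.End.eigenspace TOmega (3) ↔ (∀ μ ν, F μ ν = -F ν μ) ∧
    F 1 2 = F 0 3 ∧
    F 1 3 = -F 0 2 ∧
    F 1 4 = F 0 5 ∧
    F 1 5 = -F 0 4 ∧
    F 1 6 = F 0 7 ∧
    F 1 7 = -F 0 6 ∧
    F 2 3 = F 0 1 ∧
    F 2 4 = F 0 6 ∧
    F 2 5 = -F 0 7 ∧
    F 2 6 = -F 0 4 ∧
    F 2 7 = F 0 5 ∧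
    F 3 4 = -F 0 7 ∧
    F 3 5 = -F 0 6 ∧
    F 3 6 = F 0 5 ∧
    F 3 7 = F 0 4 ∧
    F 4 5 = F 0 1 ∧
    F 4 6 = F 0 2 ∧
    F 4 7 = -F 0 3 ∧
    F 5 6 = -F 0 3 ∧
    F 5 7 = -F 0 2 ∧
    F 6 7 = F 0 1 := by
  rw [Submodule.mem_inf, Module.End.mem_eigenspace_iff]
  refine and_congr_right fun hF => ?_
  replace hF : ∀ μ ν, F μ ν = -F ν μ := hF
  have hsm : ∀ μ ν, ((3 : ℝ) • F) μ ν = (3) * F μ ν := fun _ _ => rfl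
  have hT := TOmega_eq F hF
  constructor
  · intro h
    simp only [h, hsm] at hT
    obtain ⟨t01, t02, t03, t04, t05, t06, t07, t12, t13, t14, t15, t16, t17, t23, t24, t25, t26, t27, t34, t35, t36, t37, t45, t46, t47, t56, t57, t67⟩ := hT
    exact ⟨by linarith only [t03, t12, t47, t56],
      by linarith only [t02, t13, t46, t57],
      by linarith only [t05, t14, t27, t36],
      by linarith only [t04, t15, t26, t37],
      by linarith only [t07, t16, t25, t34],
      by linarith only [t06, t17, t24, t35],
      by linarith only [t01, t23, t45, t67],
      by linarith only [t06, t17, t24, t35],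
      by linarith only [t07, t16, t25, t34],
      by linarith only [t04, t15, t26, t37],
      by linarith only [t05, t14, t27, t36],
      by linarith only [t07, t16, t25, t34],
      by linarith only [t06, t17, t24, t35],
      by linarith only [t05, t14, t27, t36],
      by linarith only [t04, t15, t26, t37],
      by linarith only [t01, t23, t45, t67],
      by linarith only [t02, t13, t46, t57],
      by linarith only [t03, t12, t47, t56],
      by linarith only [t03, t12, t47, t56],
      by linarith only [t02, t13, t46, t57],
      by linarith only [t01, t23, t45, t67]⟩
  · rintro ⟨h12, h13, h14, h15, h16, h17, h23, h24, h25, h26, h27, h34, h35, h36, h37, h45, h46, h47, h56, h57, h67⟩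
    refine skew_ext _ _ (TOmega_skew F hF) (fun μ ν => ?_) ?_
    · rw [hsm, hsm, hF μ ν]; ring
    obtain ⟨t01, t02, t03, t04, t05, t06, t07, t12, t13, t14, t15, t16, t17, t23, t24, t25, t26, t27, t34, t35, t36, t37, t45, t46, t47, t56, t57, t67⟩ := hT
    simp only [hsm, t01, t02, t03, t04, t05, t06, t07, t12, t13, t14, t15, t16, t17, t23, t24, t25, t26, t27, t34, t35, t36, t37, t45, t46, t47, t56, t57, t67]
    exact ⟨by linarith only [h23, h45, h67],
      by linarith only [h13, h46, h57],
      by linarith only [h12, h47, h56],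
      by linarith only [h15, h26, h37],
      by linarith only [h14, h27, h36],
      by linarith only [h17, h24, h35],
      by linarith only [h16, h25, h34],
      by linarith only [h12, h47, h56],
      by linarith only [h13, h46, h57],
      by linarith only [h14, h27, h36],
      by linarith only [h15, h26, h37],
      by linarith only [h16, h25, h34],
      by linarith only [h17, h24, h35],
      by linarith only [h23, h45, h67],
      by linarith only [h17, h24, h35],
      by linarith only [h16, h25, h34],
      by linarith only [h15, h26, h37],
      by linarith only [h14, h27, h36],
      by linarith only [h16, h25, h34],
      by linarith only [h17, h24, h35],
      by linarith only [h14, h27, h36],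
      by linarith only [h15, h26, h37],
      by linarith only [h23, h45, h67],
      by linarith only [h13, h46, h57],
      by linarith only [h12, h47, h56],
      by linarith only [h12, h47, h56],
      by linarith only [h13, h46, h57],
      by linarith only [h23, h45, h67]⟩


set_option maxHeartbeats 4000000 in
lemma memm1 (F : Matrix (Fin 8) (Fin 8) ℝ) :
    F ∈ SkewMat ⊓ Module.End.eigenspace TOmega (-1) ↔ (∀ μ ν, F μ ν = -F ν μ) ∧
    F 0 1 + F 2 3 + F 4 5 + F 6 7 = 0 ∧
    F 0 2 - F 1 3 + F 4 6 - F 5 7 = 0 ∧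
    F 0 3 + F 1 2 - F 4 7 - F 5 6 = 0 ∧
    F 0 4 - F 1 5 - F 2 6 + F 3 7 = 0 ∧
    F 0 5 + F 1 4 + F 2 7 + F 3 6 = 0 ∧
    F 0 6 - F 1 7 + F 2 4 - F 3 5 = 0 ∧
    F 0 7 + F 1 6 - F 2 5 - F 3 4 = 0 := by
  rw [Submodule.mem_inf, Module.End.mem_eigenspace_iff]
  refine and_congr_right fun hF => ?_
  replace hF : ∀ μ ν, F μ ν = -F ν μ := hF
  have hsm : ∀ μ ν, ((-1 : ℝ) • F) μ ν = (-1) * F μ ν := fun _ _ => rfl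
  have hT := TOmega_eq F hF
  constructor
  · intro h
    simp only [h, hsm] at hT
    obtain ⟨t01, t02, t03, t04, t05, t06, t07, t12, t13, t14, t15, t16, t17, t23, t24, t25, t26, t27, t34, t35, t36, t37, t45, t46, t47, t56, t57, t67⟩ := hT
    exact ⟨by linarith only [t01, t23, t45, t67],
      by linarith only [t02, t13, t46, t57],
      by linarith only [t03, t12, t47, t56],
      by linarith only [t04, t15, t26, t37],
      by linarith only [t05, t14, t27, t36],
      by linarith only [t06, t17, t24, t35],
      by linarith only [t07, t16, t25, t34]⟩
  · rintro ⟨h01, h02, h03, h04, h05, h06, h07⟩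
    refine skew_ext _ _ (TOmega_skew F hF) (fun μ ν => ?_) ?_
    · rw [hsm, hsm, hF μ ν]; ring
    obtain ⟨t01, t02, t03, t04, t05, t06, t07, t12, t13, t14, t15, t16, t17, t23, t24, t25, t26, t27, t34, t35, t36, t37, t45, t46, t47, t56, t57, t67⟩ := hT
    simp only [hsm, t01, t02, t03, t04, t05, t06, t07, t12, t13, t14, t15, t16, t17, t23, t24, t25, t26, t27, t34, t35, t36, t37, t45, t46, t47, t56, t57, t67]
    exact ⟨by linarith only [h01],
      by linarith only [h02],
      by linarith only [h03],
      by linarith only [h04],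
      by linarith only [h05],
      by linarith only [h06],
      by linarith only [h07],
      by linarith only [h03],
      by linarith only [h02],
      by linarith only [h05],
      by linarith only [h04],
      by linarith only [h07],
      by linarith only [h06],
      by linarith only [h01],
      by linarith only [h06],
      by linarith only [h07],
      by linarith only [h04],
      by linarith only [h05],
      by linarith only [h07],
      by linarith only [h06],
      by linarith only [h05],
      by linarith only [h04],
      by linarith only [h01],
      by linarith only [h02],
      by linarith only [h03],
      by linarith only [h03],
      by linarith only [h02],
      by linarith only [h01]⟩


set_option maxHeartbeats 4000000 in
lemma fr3 : Module.finrank ℝ ↥(SkewMat ⊓ Module.End.eigenspace TOmega (3)) = 7 := by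
  let g : ↥(SkewMat ⊓ Module.End.eigenspace TOmega (3)) →ₗ[ℝ] (Fin 7 → ℝ) :=
    { toFun := fun F k => F.1 ((![0, 0, 0, 0, 0, 0, 0] : Fin 7 → Fin 8) k) ((![1, 2, 3, 4, 5, 6, 7] : Fin 7 → Fin 8) k)
      map_add' := fun _ _ => rfl
      map_smul' := fun _ _ => rfl }
  have hg : Function.Bijective g := by
    constructor
    · rw [injective_iff_map_eq_zero]
      rintro ⟨F, hm⟩ h0
      obtain ⟨hF, h12, h13, h14, h15, h16, h17, h23, h24, h25, h26, h27, h34, h35, h36, h37, h45, h46, h47, h56, h57, h67⟩ := (mem3 F).1 hm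
      have z01 : F 0 1 = 0 := congr_fun h0 0
      have z02 : F 0 2 = 0 := congr_fun h0 1
      have z03 : F 0 3 = 0 := congr_fun h0 2
      have z04 : F 0 4 = 0 := congr_fun h0 3
      have z05 : F 0 5 = 0 := congr_fun h0 4
      have z06 : F 0 6 = 0 := congr_fun h0 5
      have z07 : F 0 7 = 0 := congr_fun h0 6
      apply Subtype.ext
      simp only [z01, z02, z03, z04, z05, z06, z07, add_zero, sub_zero, neg_zero] at h12 h13 h14 h15 h16 h17 h23 h24 h25 h26 h27 h34 h35 h36 h37 h45 h46 h47 h56 h57 h67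
      refine skew_ext F 0 hF (fun _ _ => by simp) ?_
      simp only [z01, z02, z03, z04, z05, z06, z07, h12, h13, h14, h15, h16, h17, h23, h24, h25, h26, h27, h34, h35, h36, h37, h45, h46, h47, h56, h57, h67, Matrix.zero_apply, and_self]
    · intro v
      let u : Matrix (Fin 8) (Fin 8) ℝ := !![0, v 0, v 1, v 2, v 3, v 4, v 5, v 6;
        0, 0, v 2, -v 1, v 4, -v 3, v 6, -v 5;
        0, 0, 0, v 0, v 5, -v 6, -v 3, v 4;
        0, 0, 0, 0, -v 6, -v 5, v 4, v 3;
        0, 0, 0, 0, 0, v 0, v 1, -v 2;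
        0, 0, 0, 0, 0, 0, -v 2, -v 1;
        0, 0, 0, 0, 0, 0, 0, v 0;
        0, 0, 0, 0, 0, 0, 0, 0]
      refine ⟨⟨Matrix.of fun i j => u i j - u j i, ?_⟩, ?_⟩
      · rw [mem3]
        refine ⟨fun μ ν => by simp, ?_, ?_, ?_, ?_, ?_, ?_, ?_, ?_, ?_, ?_, ?_, ?_, ?_, ?_, ?_, ?_, ?_, ?_, ?_, ?_, ?_⟩
        all_goals (simp [u] <;> ring)
      · funext k
        change u _ _ - u _ _ = v k
        fin_cases k <;> simp [u]
  rw [(LinearEquiv.ofBijective g hg).finrank_eq, Module.finrank_fin_fun]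


set_option maxHeartbeats 4000000 in
lemma frm1 : Module.finrank ℝ ↥(SkewMat ⊓ Module.End.eigenspace TOmega (-1)) = 21 := by
  let g : ↥(SkewMat ⊓ Module.End.eigenspace TOmega (-1)) →ₗ[ℝ] (Fin 21 → ℝ) :=
    { toFun := fun F k => F.1 ((![1, 1, 1, 1, 1, 1, 2, 2, 2, 2, 2, 3, 3, 3, 3, 4, 4, 4, 5, 5, 6] : Fin 21 → Fin 8) k) ((![2, 3, 4, 5, 6, 7, 3, 4, 5, 6, 7, 4, 5, 6, 7, 5, 6, 7, 6, 7, 7] : Fin 21 → Fin 8) k)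
      map_add' := fun _ _ => rfl
      map_smul' := fun _ _ => rfl }
  have hg : Function.Bijective g := by
    constructor
    · rw [injective_iff_map_eq_zero]
      rintro ⟨F, hm⟩ h0
      obtain ⟨hF, h01, h02, h03, h04, h05, h06, h07⟩ := (memm1 F).1 hm
      have z12 : F 1 2 = 0 := congr_fun h0 0
      have z13 : F 1 3 = 0 := congr_fun h0 1
      have z14 : F 1 4 = 0 := congr_fun h0 2
      have z15 : F 1 5 = 0 := congr_fun h0 3
      have z16 : F 1 6 = 0 := congr_fun h0 4
      have z17 : F 1 7 = 0 := congr_fun h0 5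
      have z23 : F 2 3 = 0 := congr_fun h0 6
      have z24 : F 2 4 = 0 := congr_fun h0 7
      have z25 : F 2 5 = 0 := congr_fun h0 8
      have z26 : F 2 6 = 0 := congr_fun h0 9
      have z27 : F 2 7 = 0 := congr_fun h0 10
      have z34 : F 3 4 = 0 := congr_fun h0 11
      have z35 : F 3 5 = 0 := congr_fun h0 12
      have z36 : F 3 6 = 0 := congr_fun h0 13
      have z37 : F 3 7 = 0 := congr_fun h0 14
      have z45 : F 4 5 = 0 := congr_fun h0 15
      have z46 : F 4 6 = 0 := congr_fun h0 16
      have z47 : F 4 7 = 0 := congr_fun h0 17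
      have z56 : F 5 6 = 0 := congr_fun h0 18
      have z57 : F 5 7 = 0 := congr_fun h0 19
      have z67 : F 6 7 = 0 := congr_fun h0 20
      apply Subtype.ext
      simp only [z12, z13, z14, z15, z16, z17, z23, z24, z25, z26, z27, z34, z35, z36, z37, z45, z46, z47, z56, z57, z67, add_zero, sub_zero, neg_zero] at h01 h02 h03 h04 h05 h06 h07
      refine skew_ext F 0 hF (fun _ _ => by simp) ?_
      simp only [z12, z13, z14, z15, z16, z17, z23, z24, z25, z26, z27, z34, z35, z36, z37, z45, z46, z47, z56, z57, z67, h01, h02, h03, h04, h05, h06, h07, Matrix.zero_apply, and_self]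
    · intro v
      let u : Matrix (Fin 8) (Fin 8) ℝ := !![0, 0 - v 6 - v 15 - v 20, 0 + v 1 - v 16 + v 19, 0 - v 0 + v 17 + v 18, 0 + v 3 + v 9 - v 14, 0 - v 2 - v 10 - v 13, 0 + v 5 - v 7 + v 12, 0 - v 4 + v 8 + v 11;
        0, 0, v 0, v 1, v 2, v 3, v 4, v 5;
        0, 0, 0, v 6, v 7, v 8, v 9, v 10;
        0, 0, 0, 0, v 11, v 12, v 13, v 14;
        0, 0, 0, 0, 0, v 15, v 16, v 17;
        0, 0, 0, 0, 0, 0, v 18, v 19;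
        0, 0, 0, 0, 0, 0, 0, v 20;
        0, 0, 0, 0, 0, 0, 0, 0]
      refine ⟨⟨Matrix.of fun i j => u i j - u j i, ?_⟩, ?_⟩
      · rw [memm1]
        refine ⟨fun μ ν => by simp, ?_, ?_, ?_, ?_, ?_, ?_, ?_⟩
        all_goals (simp [u] <;> ring)
      · funext k
        change u _ _ - u _ _ = v k
        fin_cases k <;> simp [u]
  rw [(LinearEquiv.ofBijective g hg).finrank_eq, Module.finrank_fin_fun]


set_option maxHeartbeats 4000000 in
lemma skew_le (F : Matrix (Fin 8) (Fin 8) ℝ) (hF : F ∈ SkewMat) :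
    F ∈ (SkewMat ⊓ Module.End.eigenspace TOmega (-1)) ⊔
      (SkewMat ⊓ Module.End.eigenspace TOmega 3) := by
  replace hF : ∀ μ ν, F μ ν = -F ν μ := hF
  have hTs := TOmega_skew F hF
  obtain ⟨t01, t02, t03, t04, t05, t06, t07, t12, t13, t14, t15, t16, t17, t23, t24, t25, t26, t27, t34, t35, t36, t37, t45, t46, t47, t56, t57, t67⟩ := TOmega_eq F hF
  rw [Submodule.mem_sup]
  refine ⟨(1 / 4 : ℝ) • ((3 : ℝ) • F - TOmega F), ?_, (1 / 4 : ℝ) • (F + TOmega F), ?_, ?_⟩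
  · rw [memm1]
    simp only [Matrix.smul_apply, Matrix.sub_apply, smul_eq_mul]
    refine ⟨fun μ ν => ?_, ?_, ?_, ?_, ?_, ?_, ?_, ?_⟩
    · rw [hTs μ ν, hF μ ν]; ring
    all_goals (simp only [t01, t02, t03, t04, t05, t06, t07, t12, t13, t14, t15, t16, t17, t23, t24, t25, t26, t27, t34, t35, t36, t37, t45, t46, t47, t56, t57, t67]; ring)
  · rw [mem3]
    simp only [Matrix.smul_apply, Matrix.add_apply, smul_eq_mul]
    refine ⟨fun μ ν => ?_, ?_, ?_, ?_, ?_, ?_, ?_, ?_, ?_, ?_, ?_, ?_, ?_, ?_, ?_, ?_, ?_, ?_, ?_, ?_, ?_, ?_⟩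
    · rw [hTs μ ν, hF μ ν]; ring
    all_goals (simp only [t01, t02, t03, t04, t05, t06, t07, t12, t13, t14, t15, t16, t17, t23, t24, t25, t26, t27, t34, t35, t36, t37, t45, t46, t47, t56, t57, t67]; ring)
  · ext μ ν
    simp only [Matrix.smul_apply, Matrix.add_apply, Matrix.sub_apply, smul_eq_mul]
    ring

/-- The eigenspace of `T` with eigenvalue `-1` (inside the antisymmetric matrices) has
dimension 21, the eigenspace with eigenvalue `3` has dimension 7, and the space of
antisymmetric matrices is the direct sum of these two eigenspaces. -/
theorem TOmega_eigenspace_decomposition :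
    Module.finrank ℝ ↥(SkewMat ⊓ Module.End.eigenspace TOmega (-1)) = 21 ∧
    Module.finrank ℝ ↥(SkewMat ⊓ Module.End.eigenspace TOmega 3) = 7 ∧
    Disjoint (SkewMat ⊓ Module.End.eigenspace TOmega (-1))
      (SkewMat ⊓ Module.End.eigenspace TOmega 3) ∧
    (SkewMat ⊓ Module.End.eigenspace TOmega (-1)) ⊔
      (SkewMat ⊓ Module.End.eigenspace TOmega 3) = SkewMat := by

  refine ⟨frm1, fr3, ?_, le_antisymm (sup_le inf_le_left inf_le_left) skew_le⟩
  rw [Submodule.disjoint_def]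
  intro F h1 h2
  have a1 := Module.End.mem_eigenspace_iff.1 h1.2
  have a2 := Module.End.mem_eigenspace_iff.1 h2.2
  rw [a1] at a2
  ext μ ν
  have := congr_fun (congr_fun a2 μ) ν
  simp only [Matrix.smul_apply, smul_eq_mul] at this
  simp only [Matrix.zero_apply]
  linarith
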